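/- arXiv:1909.00630 — 2 statements merged into one kernel-verified Lean document; each statement's English description precedes it below -/
import Mathlib

section
/- (Korn inequality on the strip) There exists C > 0 such that for every divergence-free u ∈ H^1(ℝ×(0,1);ℝ²) with u²(x,0)=u²(x,1)=0, one has ‖D(u)‖_{L^2} ≥ C ‖u‖_{H^1}, with D(u)=(∇u+(∇u)^T)/2 and norms over Ω = ℝ×(0,1). -/
open MeasureTheory Set

/-- The strip `Ω = ℝ × (0,1)` in `ℝ²`. -/
def strip : Set (ℝ × ℝ) := Set.univ ×ˢ Set.Ioo (0 : ℝ) 1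

/-- Horizontal partial derivative. -/
noncomputable def dx (g : ℝ × ℝ → ℝ) (q : ℝ × ℝ) : ℝ := fderiv ℝ g q (1, 0)

/-- Vertical partial derivative. -/
noncomputable def dy (g : ℝ × ℝ → ℝ) (q : ℝ × ℝ) : ℝ := fderiv ℝ g q (0, 1)

/-- Squared Frobenius norm of the symmetric gradient `D(u) = (∇u + ∇uᵀ)/2` in 2D. -/
noncomputable def Dsq (u : ℝ × ℝ → ℝ × ℝ) (p : ℝ × ℝ) : ℝ :=
  (dx (fun q => (u q).1) p) ^ 2 + (dy (fun q => (u q).2) p) ^ 2 +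
    (dx (fun q => (u q).2) p + dy (fun q => (u q).1) p) ^ 2 / 2

theorem hasDerivAt_horizontal {a : ℝ × ℝ → ℝ} (ha : ContDiff ℝ 1 a) (x y : ℝ) :
    HasDerivAt (fun t => a (t, y)) (dx a (x, y)) x := by
  have h := (ha.differentiable one_ne_zero (x, y)).hasFDerivAt
  exact h.comp_hasDerivAt x ((hasDerivAt_id x).prodMk (hasDerivAt_const x y))

theorem hasDerivAt_vertical {a : ℝ × ℝ → ℝ} (ha : ContDiff ℝ 1 a) (x y : ℝ) :
    HasDerivAt (fun t => a (x, t)) (dy a (x, y)) y := by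
  have h := (ha.differentiable one_ne_zero (x, y)).hasFDerivAt
  exact h.comp_hasDerivAt y ((hasDerivAt_const y x).prodMk (hasDerivAt_id y))

theorem continuous_dx {a : ℝ × ℝ → ℝ} (ha : ContDiff ℝ 1 a) : Continuous (dx a) :=
  (ha.continuous_fderiv one_ne_zero).clm_apply continuous_const

theorem continuous_dy {a : ℝ × ℝ → ℝ} (ha : ContDiff ℝ 1 a) : Continuous (dy a) :=
  (ha.continuous_fderiv one_ne_zero).clm_apply continuous_const

/-- A `C¹` function is Lipschitz in the horizontal variable, uniformly for `y ∈ [0,1]`. -/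
theorem exists_horizontal_lipschitz {a : ℝ × ℝ → ℝ} (ha : ContDiff ℝ 1 a) (x : ℝ) :
    ∃ K : ℝ, ∀ t ∈ Icc (x - 1) (x + 1), ∀ y ∈ Icc (0 : ℝ) 1,
      |a (t, y) - a (x, y)| ≤ K * |t - x| := by
  obtain ⟨K, hK⟩ := ha.contDiffOn.exists_lipschitzOnWith one_ne_zero
    ((convex_Icc (x - 1) (x + 1)).prod (convex_Icc (0 : ℝ) 1)) (isCompact_Icc.prod isCompact_Icc)
  refine ⟨K, fun t ht y hy => ?_⟩
  have h := hK.dist_le_mul (t, y) ⟨ht, hy⟩ (x, y) ⟨by simp, hy⟩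
  simpa [Prod.dist_eq, Real.dist_eq] using h

/-- Transport of the signed area `∫ a ∂_y b dy` along the strip. No second derivatives are
needed, thanks to the boundary condition on `b`. -/
theorem hasDerivAt_integral_mul_dy {a b : ℝ × ℝ → ℝ} (ha : ContDiff ℝ 1 a) (hb : ContDiff ℝ 1 b)
    (hb0 : ∀ x, b (x, 0) = 0) (hb1 : ∀ x, b (x, 1) = 0) (x : ℝ) :
    HasDerivAt (fun t => ∫ y in (0 : ℝ)..1, a (t, y) * dy b (t, y))
      (∫ y in (0 : ℝ)..1, (dx a (x, y) * dy b (x, y) - dy a (x, y) * dx b (x, y))) x := by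
  have hca := ha.continuous
  have hcb := hb.continuous
  have hcay := continuous_dy ha
  have hcby := continuous_dy hb
  have parts (t : ℝ) : (∫ y in (0 : ℝ)..1, a (t, y) * dy b (t, y)) -
      ∫ y in (0 : ℝ)..1, a (x, y) * dy b (x, y) =
      ∫ y in (0 : ℝ)..1, ((a (t, y) - a (x, y)) * dy b (t, y) -
        dy a (x, y) * (b (t, y) - b (x, y))) := by
    have h := intervalIntegral.integral_mul_deriv_eq_deriv_mul (a := 0) (b := 1)
      (u := fun y => a (x, y)) (u' := fun y => dy a (x, y))
      (v := fun y => b (t, y) - b (x, y)) (v' := fun y => dy b (t, y) - dy b (x, y))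
      (fun y _ => hasDerivAt_vertical ha x y)
      (fun y _ => (hasDerivAt_vertical hb t y).sub (hasDerivAt_vertical hb x y))
      ((by fun_prop : Continuous _).intervalIntegrable _ _)
      ((by fun_prop : Continuous _).intervalIntegrable _ _)
    simp only [hb0, hb1, sub_self, mul_zero, zero_sub] at h
    have int {f : ℝ → ℝ} (hf : Continuous f) : IntervalIntegrable f volume 0 1 :=
      hf.intervalIntegrable _ _
    simp only [sub_mul, mul_sub (a (x, _))] at h ⊢
    rw [intervalIntegral.integral_sub (int (by fun_prop)) (int (by fun_prop))] at h
    rw [intervalIntegral.integral_sub (int (by fun_prop)) (int (by fun_prop)),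
      intervalIntegral.integral_sub (int (by fun_prop)) (int (by fun_prop))]
    linarith
  obtain ⟨K, hK⟩ := exists_horizontal_lipschitz ha x
  obtain ⟨L, hL⟩ := exists_horizontal_lipschitz hb x
  obtain ⟨M, hM⟩ := ((isCompact_Icc (a := x - 1) (b := x + 1)).prod
    (isCompact_Icc (a := (0 : ℝ)) (b := 1))).exists_bound_of_continuousOn hcby.continuousOn
  obtain ⟨N, hN⟩ := ((isCompact_Icc (a := x - 1) (b := x + 1)).prod
    (isCompact_Icc (a := (0 : ℝ)) (b := 1))).exists_bound_of_continuousOn hcay.continuousOn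
  rw [hasDerivAt_iff_tendsto_slope]
  have hslope : slope (fun t => ∫ y in (0 : ℝ)..1, a (t, y) * dy b (t, y)) x = fun t =>
      ∫ y in (0 : ℝ)..1, ((t - x)⁻¹ * (a (t, y) - a (x, y)) * dy b (t, y) -
        dy a (x, y) * ((t - x)⁻¹ * (b (t, y) - b (x, y)))) := by
    ext t
    rw [slope_def_field, parts, div_eq_inv_mul, ← intervalIntegral.integral_const_mul]
    congr 1
    ext y
    ring
  rw [hslope]
  have hne : ∀ᶠ t in nhdsWithin x {x}ᶜ, t ≠ x := self_mem_nhdsWithin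
  have hnear : ∀ᶠ t in nhdsWithin x {x}ᶜ, t ∈ Icc (x - 1) (x + 1) :=
    mem_nhdsWithin_of_mem_nhds (Icc_mem_nhds (by linarith) (by linarith))
  refine intervalIntegral.tendsto_integral_filter_of_dominated_convergence
    (fun _ => K * M + N * L) (Filter.Eventually.of_forall fun t =>
      (by fun_prop : Continuous _).aestronglyMeasurable) ?_ intervalIntegrable_const ?_
  · filter_upwards [hne, hnear] with t ht htI
    refine Filter.Eventually.of_forall fun y hy => ?_
    rw [uIoc_of_le zero_le_one] at hy
    have hy' : y ∈ Icc (0 : ℝ) 1 := ⟨hy.1.le, hy.2⟩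
    have hpos : 0 < |t - x| := abs_pos.2 (sub_ne_zero.2 ht)
    have quot {c d : ℝ} (h : |c| ≤ d * |t - x|) : |(t - x)⁻¹ * c| ≤ d := by
      rw [abs_mul, abs_inv, inv_mul_le_iff₀ hpos]
      linarith
    have h1 := quot (hK t htI y hy')
    have h2 := quot (hL t htI y hy')
    have h3 : |dy b (t, y)| ≤ M := hM (t, y) ⟨htI, hy'⟩
    have h4 : |dy a (x, y)| ≤ N := hN (x, y) ⟨by simp, hy'⟩
    refine (abs_sub _ _).trans (add_le_add ?_ ?_) <;> rw [abs_mul] <;>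
      exact mul_le_mul ‹_› ‹_› (abs_nonneg _) ((abs_nonneg _).trans ‹_›)
  · refine Filter.Eventually.of_forall fun y _ => ?_
    have sl {f : ℝ × ℝ → ℝ} (hf : ContDiff ℝ 1 f) :
        Filter.Tendsto (fun t => (t - x)⁻¹ * (f (t, y) - f (x, y))) (nhdsWithin x {x}ᶜ)
          (nhds (dx f (x, y))) := by
      have := hasDerivAt_iff_tendsto_slope.1 (hasDerivAt_horizontal hf x y)
      simpa only [slope_fun_def, smul_eq_mul, vsub_eq_sub] using this
    have hby : Filter.Tendsto (fun t => dy b (t, y)) (nhdsWithin x {x}ᶜ) (nhds (dy b (x, y))) :=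
      ((by fun_prop : Continuous fun t => dy b (t, y)).tendsto x).mono_left nhdsWithin_le_nhds
    exact ((sl ha).mul hby).sub ((sl hb).const_mul _)

theorem hasDerivAt_integral_horizontal {a : ℝ × ℝ → ℝ} (ha : ContDiff ℝ 1 a) (x : ℝ) :
    HasDerivAt (fun t => ∫ y in (0 : ℝ)..1, a (t, y)) (∫ y in (0 : ℝ)..1, dx a (x, y)) x := by
  have hca := ha.continuous
  have hcax := continuous_dx ha
  obtain ⟨M, hM⟩ := ((isCompact_Icc (a := x - 1) (b := x + 1)).prod
    (isCompact_Icc (a := (0 : ℝ)) (b := 1))).exists_bound_of_continuousOn hcax.continuousOn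
  refine (intervalIntegral.hasDerivAt_integral_of_dominated_loc_of_deriv_le
    (F' := fun t y => dx a (t, y)) (bound := fun _ => M) (s := Icc (x - 1) (x + 1))
    (Icc_mem_nhds (by linarith) (by linarith))
    (Filter.Eventually.of_forall fun t => (by fun_prop : Continuous _).aestronglyMeasurable)
    ((by fun_prop : Continuous _).intervalIntegrable _ _)
    (by fun_prop : Continuous _).aestronglyMeasurable
    (Filter.Eventually.of_forall fun y hy t ht => ?_) intervalIntegrable_const
    (Filter.Eventually.of_forall fun y _ t _ => hasDerivAt_horizontal ha t y)).2
  rw [uIoc_of_le zero_le_one] at hy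
  exact hM (t, y) ⟨ht, hy.1.le, hy.2⟩

/-- Cauchy-Schwarz on a subinterval of `[0,1]`. -/
theorem sq_integral_le_integral_sq {g : ℝ → ℝ} (hg : Continuous g) {s t : ℝ}
    (hs : s ∈ Icc (0 : ℝ) 1) (ht : t ∈ Icc (0 : ℝ) 1) :
    (∫ y in s..t, g y) ^ 2 ≤ ∫ y in (0 : ℝ)..1, g y ^ 2 := by
  wlog hst : s ≤ t generalizing s t
  · rw [intervalIntegral.integral_symm, neg_sq]
    exact this ht hs (le_of_not_ge hst)
  set I := ∫ y in s..t, g y with hI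
  have int {f : ℝ → ℝ} (hf : Continuous f) {c d : ℝ} : IntervalIntegrable f volume c d :=
    hf.intervalIntegrable _ _
  have h0 : 0 ≤ ∫ y in s..t, (g y - I) ^ 2 :=
    intervalIntegral.integral_nonneg hst fun y _ => sq_nonneg _
  have h1 : ∫ y in s..t, (g y - I) ^ 2 =
      (∫ y in s..t, g y ^ 2) - 2 * I * I + (t - s) * I ^ 2 := by
    have : ∀ y, (g y - I) ^ 2 = g y ^ 2 - 2 * I * g y + I ^ 2 := fun y => by ring
    simp only [this]
    rw [intervalIntegral.integral_add (int (by fun_prop)) (int (by fun_prop)),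
      intervalIntegral.integral_sub (int (by fun_prop)) (int (by fun_prop)),
      intervalIntegral.integral_const_mul, intervalIntegral.integral_const, smul_eq_mul, ← hI]
  have h2 : ∫ y in s..t, g y ^ 2 ≤ ∫ y in (0 : ℝ)..1, g y ^ 2 :=
    intervalIntegral.integral_mono_interval hs.1 hst ht.2
      (Filter.Eventually.of_forall fun y => sq_nonneg _) (int (by fun_prop))
  nlinarith [mul_nonneg (sub_nonneg.2 (show t - s ≤ 1 by linarith [hs.1, ht.2])) (sq_nonneg I)]

theorem volume_restrict_strip :
    (volume.restrict strip : Measure (ℝ × ℝ)) =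
      (volume : Measure ℝ).prod (volume.restrict (Ioc (0 : ℝ) 1)) := by
  rw [strip, Measure.volume_eq_prod, ← Measure.prod_restrict, Measure.restrict_univ,
    Measure.restrict_congr_set Ioo_ae_eq_Ioc]

theorem integrable_integral_of_integrableOn_strip {g : ℝ × ℝ → ℝ} (hg : IntegrableOn g strip) :
    Integrable fun x => ∫ y in (0 : ℝ)..1, g (x, y) := by
  simp only [intervalIntegral.integral_of_le zero_le_one]
  rw [IntegrableOn, volume_restrict_strip] at hg
  exact hg.integral_prod_left

theorem integral_strip {g : ℝ × ℝ → ℝ} (hg : IntegrableOn g strip) :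
    ∫ p in strip, g p = ∫ x, ∫ y in (0 : ℝ)..1, g (x, y) := by
  simp only [intervalIntegral.integral_of_le zero_le_one]
  rw [IntegrableOn, volume_restrict_strip] at hg
  rw [volume_restrict_strip, integral_prod _ hg]

/-- The Jacobian determinant of `(a, b)` has zero mean over the strip if `b` vanishes on its
boundary. -/
theorem integral_strip_jacobian {a b : ℝ × ℝ → ℝ} (ha : ContDiff ℝ 1 a) (hb : ContDiff ℝ 1 b)
    (hb0 : ∀ x, b (x, 0) = 0) (hb1 : ∀ x, b (x, 1) = 0)
    (hab : IntegrableOn (fun p => a p * dy b p) strip)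
    (hJ : IntegrableOn (fun p => dx a p * dy b p - dy a p * dx b p) strip) :
    ∫ p in strip, (dx a p * dy b p - dy a p * dx b p) = 0 := by
  rw [integral_strip hJ]
  exact integral_eq_zero_of_hasDerivAt_of_integrable (hasDerivAt_integral_mul_dy ha hb hb0 hb1)
    (integrable_integral_of_integrableOn_strip hJ) (integrable_integral_of_integrableOn_strip hab)

/-- Poincaré inequality for functions with a zero on each vertical section of the strip. -/
theorem poincare_strip {f : ℝ × ℝ → ℝ} (hf : ContDiff ℝ 1 f)
    (hz : ∀ x, ∃ z ∈ Icc (0 : ℝ) 1, f (x, z) = 0)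
    (hf2 : IntegrableOn (fun p => f p ^ 2) strip)
    (hd2 : IntegrableOn (fun p => dy f p ^ 2) strip) :
    ∫ p in strip, f p ^ 2 ≤ ∫ p in strip, dy f p ^ 2 := by
  have hcf := hf.continuous
  have hcd := continuous_dy hf
  rw [integral_strip hf2, integral_strip hd2]
  refine integral_mono (integrable_integral_of_integrableOn_strip hf2)
    (integrable_integral_of_integrableOn_strip hd2) fun x => ?_
  obtain ⟨z, hz, hfz⟩ := hz x
  have hle : ∀ y ∈ Icc (0 : ℝ) 1, f (x, y) ^ 2 ≤ ∫ y in (0 : ℝ)..1, dy f (x, y) ^ 2 := by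
    intro y hy
    have h := intervalIntegral.integral_eq_sub_of_hasDerivAt (a := z) (b := y)
      (fun t _ => hasDerivAt_vertical hf x t) ((by fun_prop : Continuous _).intervalIntegrable _ _)
    rw [hfz, sub_zero] at h
    rw [← h]
    exact sq_integral_le_integral_sq (by fun_prop) hz hy
  have hint : IntervalIntegrable (fun y => f (x, y) ^ 2) volume 0 1 :=
    (by fun_prop : Continuous _).intervalIntegrable 0 1
  simpa using intervalIntegral.integral_mono_on zero_le_one hint intervalIntegrable_const hle

/-- The flux of a square integrable divergence-free field through vertical sections vanishes. -/
theorem integral_vertical_section_eq_zero {a b : ℝ × ℝ → ℝ} (ha : ContDiff ℝ 1 a)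
    (hb : ContDiff ℝ 1 b) (hdiv : ∀ p, dx a p + dy b p = 0)
    (hb0 : ∀ x, b (x, 0) = 0) (hb1 : ∀ x, b (x, 1) = 0)
    (ha2 : IntegrableOn (fun p => a p ^ 2) strip) (x : ℝ) :
    ∫ y in (0 : ℝ)..1, a (x, y) = 0 := by
  have hca := ha.continuous
  have hcb := continuous_dy hb
  set M : ℝ → ℝ := fun x => ∫ y in (0 : ℝ)..1, a (x, y) with hM
  have hderiv (t : ℝ) : HasDerivAt M 0 t := by
    convert hasDerivAt_integral_horizontal ha t using 1
    have h := intervalIntegral.integral_eq_sub_of_hasDerivAt (a := 0) (b := 1)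
      (fun y _ => hasDerivAt_vertical hb t y) ((by fun_prop : Continuous _).intervalIntegrable _ _)
    simp only [eq_neg_of_add_eq_zero_left (hdiv _), intervalIntegral.integral_neg, h, hb0, hb1,
      sub_self, neg_zero]
  have hconst (t : ℝ) : M t = M x :=
    is_const_of_deriv_eq_zero (fun s => (hderiv s).differentiableAt) (fun s => (hderiv s).deriv) t x
  have hint : Integrable fun _ : ℝ => M x ^ 2 := by
    refine (integrable_integral_of_integrableOn_strip ha2).mono' (by fun_prop)
      (Filter.Eventually.of_forall fun t => ?_)
    rw [Real.norm_of_nonneg (sq_nonneg _), ← hconst t]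
    exact sq_integral_le_integral_sq (by fun_prop) (by simp) (by simp)
  rcases integrable_const_iff.1 hint with h | h
  · exact pow_eq_zero_iff two_ne_zero |>.1 h
  · exact absurd (measure_lt_top (volume : Measure ℝ) univ) (by simp)

theorem exists_vertical_zero {a : ℝ × ℝ → ℝ} (ha : Continuous a) {x : ℝ}
    (h : ∫ y in (0 : ℝ)..1, a (x, y) = 0) : ∃ z ∈ Icc (0 : ℝ) 1, a (x, z) = 0 := by
  obtain ⟨c, hc, hac⟩ := exists_eq_interval_average zero_ne_one
    (by fun_prop : Continuous fun y => a (x, y)).continuousOn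
  rw [interval_average_eq, h, smul_zero] at hac
  rw [uIoo_of_le zero_le_one] at hc
  exact ⟨c, Ioo_subset_Icc_self hc, hac⟩

/-- The operator norm on `ℝ² → ℝ²` (sup norms) is controlled by the Frobenius norm. -/
theorem norm_sq_fderiv_le {u : ℝ × ℝ → ℝ × ℝ} (hu : ContDiff ℝ 1 u) (p : ℝ × ℝ) :
    ‖fderiv ℝ u p‖ ^ 2 ≤
      2 * (dx (fun q => (u q).1) p ^ 2 + dy (fun q => (u q).1) p ^ 2 +
        dx (fun q => (u q).2) p ^ 2 + dy (fun q => (u q).2) p ^ 2) := by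
  have hd := hu.differentiable one_ne_zero p
  have e1 : fderiv ℝ (fun q => (u q).1) p = (ContinuousLinearMap.fst ℝ ℝ ℝ).comp (fderiv ℝ u p) :=
    (hd.hasFDerivAt.fst).fderiv
  have e2 : fderiv ℝ (fun q => (u q).2) p = (ContinuousLinearMap.snd ℝ ℝ ℝ).comp (fderiv ℝ u p) :=
    (hd.hasFDerivAt.snd).fderiv
  have hcomb (L : ℝ × ℝ →L[ℝ] ℝ) (v : ℝ × ℝ) :
      |L v| ≤ (|L (1, 0)| + |L (0, 1)|) * ‖v‖ := by
    have hv : v = v.1 • ((1 : ℝ), (0 : ℝ)) + v.2 • ((0 : ℝ), (1 : ℝ)) := by ext <;> simp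
    have h : L v = v.1 * L (1, 0) + v.2 * L (0, 1) := by
      conv_lhs => rw [hv, map_add, map_smul, map_smul, smul_eq_mul, smul_eq_mul]
    rw [h, add_mul]
    refine (abs_add_le _ _).trans (add_le_add ?_ ?_) <;> rw [abs_mul, mul_comm] <;> gcongr
    · exact norm_fst_le v
    · exact norm_snd_le v
  have hsq (α β γ δ : ℝ) : |α| + |β| ≤ √(2 * (α ^ 2 + β ^ 2 + γ ^ 2 + δ ^ 2)) := by
    refine Real.le_sqrt_of_sq_le ?_
    nlinarith [sq_nonneg (|α| - |β|), sq_abs α, sq_abs β, sq_nonneg γ, sq_nonneg δ]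
  simp only [dx, dy, e1, e2]
  set L₁ := (ContinuousLinearMap.fst ℝ ℝ ℝ).comp (fderiv ℝ u p) with hL₁
  set L₂ := (ContinuousLinearMap.snd ℝ ℝ ℝ).comp (fderiv ℝ u p) with hL₂
  set N := L₁ (1, 0) ^ 2 + L₁ (0, 1) ^ 2 + L₂ (1, 0) ^ 2 + L₂ (0, 1) ^ 2 with hN
  have hop : ‖fderiv ℝ u p‖ ≤ √(2 * N) := by
    refine ContinuousLinearMap.opNorm_le_bound _ (Real.sqrt_nonneg _) fun v => ?_
    rw [Prod.norm_def]
    refine max_le ((hcomb L₁ v).trans ?_) ((hcomb L₂ v).trans ?_) <;> gcongr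
    · exact hsq _ _ _ _
    · refine (hsq (L₂ (1, 0)) (L₂ (0, 1)) (L₁ (1, 0)) (L₁ (0, 1))).trans_eq ?_
      rw [hN]
      ring_nf
  calc ‖fderiv ℝ u p‖ ^ 2 ≤ √(2 * N) ^ 2 := by gcongr
    _ = 2 * N := Real.sq_sqrt (by positivity)

/-- Each component of the derivative is controlled by the operator norm. -/
theorem norm_fderiv_comp_apply_le {u : ℝ × ℝ → ℝ × ℝ} (hu : ContDiff ℝ 1 u)
    (ℓ : ℝ × ℝ →L[ℝ] ℝ) (hℓ : ∀ w, ‖ℓ w‖ ≤ ‖w‖) (p : ℝ × ℝ) {v : ℝ × ℝ} (hv : ‖v‖ = 1) :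
    ‖fderiv ℝ (fun q => ℓ (u q)) p v‖ ≤ ‖fderiv ℝ u p‖ := by
  have hd := hu.differentiable one_ne_zero p
  have h : fderiv ℝ (fun q => ℓ (u q)) p = ℓ.comp (fderiv ℝ u p) :=
    (ℓ.hasFDerivAt.comp p hd.hasFDerivAt).fderiv
  rw [h]
  have := (fderiv ℝ u p).le_opNorm v
  rw [hv, mul_one] at this
  exact (hℓ _).trans this

theorem integrableOn_sq_of_norm_le {g : ℝ × ℝ → ℝ} {G : ℝ × ℝ → ℝ} {s : Set (ℝ × ℝ)}
    (hg : Continuous g) (hG : IntegrableOn (fun p => G p ^ 2) s) (h : ∀ p, ‖g p‖ ≤ G p) :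
    IntegrableOn (fun p => g p ^ 2) s := by
  refine hG.mono' (by fun_prop) (Filter.Eventually.of_forall fun p => ?_)
  rw [norm_pow]
  gcongr
  exact h p

theorem integrableOn_mul_of_sq {f g : ℝ × ℝ → ℝ} {s : Set (ℝ × ℝ)}
    (hf : Continuous f) (hg : Continuous g) (hf2 : IntegrableOn (fun p => f p ^ 2) s)
    (hg2 : IntegrableOn (fun p => g p ^ 2) s) : IntegrableOn (fun p => f p * g p) s := by
  refine (hf2.add hg2).mono' (by fun_prop) (Filter.Eventually.of_forall fun p => ?_)
  rw [norm_mul, Pi.add_apply, ← sq_abs (f p), ← sq_abs (g p), Real.norm_eq_abs, Real.norm_eq_abs]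
  nlinarith [sq_nonneg (|f p| - |g p|), sq_nonneg |f p|, sq_nonneg |g p|]

/-- The squared form of Korn's inequality on the strip. -/
theorem korn_strip_sq {u : ℝ × ℝ → ℝ × ℝ} (hu : ContDiff ℝ 1 u)
    (hdiv : ∀ p : ℝ × ℝ, dx (fun q => (u q).1) p + dy (fun q => (u q).2) p = 0)
    (hbd : ∀ x : ℝ, (u (x, 0)).2 = 0 ∧ (u (x, 1)).2 = 0)
    (hu2 : IntegrableOn (fun p => ‖u p‖ ^ 2) strip)
    (hdu2 : IntegrableOn (fun p => ‖fderiv ℝ u p‖ ^ 2) strip) :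
    (∫ p in strip, ‖u p‖ ^ 2) + (∫ p in strip, ‖fderiv ℝ u p‖ ^ 2) ≤
      6 * ∫ p in strip, Dsq u p := by
  have hfr := norm_sq_fderiv_le hu
  have hpx : ‖((1 : ℝ), (0 : ℝ))‖ = 1 := by simp [Prod.norm_def]
  have hpy : ‖((0 : ℝ), (1 : ℝ))‖ = 1 := by simp [Prod.norm_def]
  have hl1 := norm_fderiv_comp_apply_le hu (ContinuousLinearMap.fst ℝ ℝ ℝ) norm_fst_le
  have hl2 := norm_fderiv_comp_apply_le hu (ContinuousLinearMap.snd ℝ ℝ ℝ) norm_snd_le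
  have hD (p : ℝ × ℝ) : Dsq u p = dx (fun q => (u q).1) p ^ 2 + dy (fun q => (u q).2) p ^ 2 +
    (dx (fun q => (u q).2) p + dy (fun q => (u q).1) p) ^ 2 / 2 := rfl
  have ha : ContDiff ℝ 1 fun q => (u q).1 := contDiff_fst.comp hu
  have hb : ContDiff ℝ 1 fun q => (u q).2 := contDiff_snd.comp hu
  have hua (p : ℝ × ℝ) : ‖(u p).1‖ ≤ ‖u p‖ := norm_fst_le _
  have hub (p : ℝ × ℝ) : ‖(u p).2‖ ≤ ‖u p‖ := norm_snd_le _
  have hun (p : ℝ × ℝ) : ‖u p‖ ^ 2 ≤ (u p).1 ^ 2 + (u p).2 ^ 2 := by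
    rw [Prod.norm_def]
    rcases max_choice ‖(u p).1‖ ‖(u p).2‖ with h | h <;> rw [h, Real.norm_eq_abs, sq_abs]
    · exact le_add_of_nonneg_right (sq_nonneg _)
    · exact le_add_of_nonneg_left (sq_nonneg _)
  have hax2 := integrableOn_sq_of_norm_le (continuous_dx ha) hdu2 fun p => hl1 p hpx
  have hay2 := integrableOn_sq_of_norm_le (continuous_dy ha) hdu2 fun p => hl1 p hpy
  have hbx2 := integrableOn_sq_of_norm_le (continuous_dx hb) hdu2 fun p => hl2 p hpx
  have hby2 := integrableOn_sq_of_norm_le (continuous_dy hb) hdu2 fun p => hl2 p hpy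
  have ha2 := integrableOn_sq_of_norm_le ha.continuous hu2 hua
  have hb2 := integrableOn_sq_of_norm_le hb.continuous hu2 hub
  generalize hA : (fun q => (u q).1) = a at *
  generalize hB : (fun q => (u q).2) = b at *
  have hav (p : ℝ × ℝ) : (u p).1 = a p := congrFun hA p
  have hbv (p : ℝ × ℝ) : (u p).2 = b p := congrFun hB p
  simp only [hav, hbv] at hun hbd ha2 hb2
  have hb0 x := (hbd x).1
  have hb1 x := (hbd x).2
  have hJ : IntegrableOn (fun p => dx a p * dy b p - dy a p * dx b p) strip :=
    (integrableOn_mul_of_sq (continuous_dx ha) (continuous_dy hb) hax2 hby2).sub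
      (integrableOn_mul_of_sq (continuous_dy ha) (continuous_dx hb) hay2 hbx2)
  have hJ0 := integral_strip_jacobian ha hb hb0 hb1
    (integrableOn_mul_of_sq ha.continuous (continuous_dy hb) ha2 hby2) hJ
  have hPa := poincare_strip ha (fun x => exists_vertical_zero ha.continuous
    (integral_vertical_section_eq_zero ha hb hdiv hb0 hb1 ha2 x)) ha2 hay2
  have hPb := poincare_strip hb (fun x => ⟨0, by simp, hb0 x⟩) hb2 hby2
  have h2 : IntegrableOn (fun p => dx a p ^ 2 + dy a p ^ 2) strip := hax2.add hay2
  have h3 : IntegrableOn (fun p => dx a p ^ 2 + dy a p ^ 2 + dx b p ^ 2) strip := h2.add hbx2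
  have h4 : IntegrableOn (fun p => dx a p ^ 2 + dy a p ^ 2 + dx b p ^ 2 + dy b p ^ 2) strip :=
    h3.add hby2
  have hsum : ∫ p in strip, (dx a p ^ 2 + dy a p ^ 2 + dx b p ^ 2 + dy b p ^ 2) =
      (∫ p in strip, dx a p ^ 2) + (∫ p in strip, dy a p ^ 2) + (∫ p in strip, dx b p ^ 2) +
        ∫ p in strip, dy b p ^ 2 := by
    rw [integral_add h3 hby2, integral_add h2 hbx2, integral_add hax2 hay2]
  have hDint : ∫ p in strip, Dsq u p = (1 / 2) * ((∫ p in strip, dx a p ^ 2) +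
      (∫ p in strip, dy a p ^ 2) + (∫ p in strip, dx b p ^ 2) + ∫ p in strip, dy b p ^ 2) := by
    have hpt (p : ℝ × ℝ) : Dsq u p = (1 / 2) * (dx a p ^ 2 + dy a p ^ 2 + dx b p ^ 2 + dy b p ^ 2) -
        (dx a p * dy b p - dy a p * dx b p) := by
      rw [hD, eq_neg_of_add_eq_zero_left (hdiv p)]
      ring
    simp only [hpt]
    rw [integral_sub (h4.const_mul (1 / 2)) hJ, hJ0, sub_zero, integral_const_mul, hsum]
  have hu_le : ∫ p in strip, ‖u p‖ ^ 2 ≤ (∫ p in strip, a p ^ 2) + ∫ p in strip, b p ^ 2 := by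
    rw [← integral_add ha2 hb2]
    exact integral_mono hu2 (ha2.add hb2) hun
  have hdu_le : ∫ p in strip, ‖fderiv ℝ u p‖ ^ 2 ≤ 2 * ((∫ p in strip, dx a p ^ 2) +
      (∫ p in strip, dy a p ^ 2) + (∫ p in strip, dx b p ^ 2) + ∫ p in strip, dy b p ^ 2) := by
    rw [← hsum, ← integral_const_mul]
    exact integral_mono hdu2 (h4.const_mul 2) hfr
  have hax0 : 0 ≤ ∫ p in strip, dx a p ^ 2 := integral_nonneg fun p => sq_nonneg _
  have hbx0 : 0 ≤ ∫ p in strip, dx b p ^ 2 := integral_nonneg fun p => sq_nonneg _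
  linarith

/-- Korn's inequality on the strip `Ω = ℝ×(0,1)`: there is `C > 0` with
`‖D(u)‖_{L²} ≥ C ‖u‖_{H¹}` for every divergence-free `u ∈ H¹(Ω;ℝ²)` with
`u²(x,0)=u²(x,1)=0`. -/
theorem korn_strip :
    ∃ C > 0, ∀ (u : ℝ × ℝ → ℝ × ℝ),
      ContDiff ℝ 1 u →
      (∀ p : ℝ × ℝ, dx (fun q => (u q).1) p + dy (fun q => (u q).2) p = 0) →
      (∀ x : ℝ, (u (x, 0)).2 = 0 ∧ (u (x, 1)).2 = 0) →
      IntegrableOn (fun p => ‖u p‖ ^ 2) strip →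
      IntegrableOn (fun p => ‖fderiv ℝ u p‖ ^ 2) strip →
      (∫ p in strip, Dsq u p) ^ ((1 : ℝ) / 2) ≥
        C * ((∫ p in strip, ‖u p‖ ^ 2) +
          (∫ p in strip, ‖fderiv ℝ u p‖ ^ 2)) ^ ((1 : ℝ) / 2) := by
  refine ⟨(1 / 6 : ℝ) ^ ((1 : ℝ) / 2), by positivity, fun u hu hdiv hbd hu2 hdu2 => ?_⟩
  have h0 : 0 ≤ (∫ p in strip, ‖u p‖ ^ 2) + ∫ p in strip, ‖fderiv ℝ u p‖ ^ 2 :=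
    add_nonneg (integral_nonneg fun p => sq_nonneg _) (integral_nonneg fun p => sq_nonneg _)
  rw [ge_iff_le, ← Real.mul_rpow (by norm_num) h0]
  refine Real.rpow_le_rpow (by positivity) ?_ (by norm_num)
  linarith [korn_strip_sq hu hdiv hbd hu2 hdu2]
end

section
/- There exists a constant C > 0, independent of L ≥ 1, such that every u ∈ H^2((-L,L)×(0,1);ℝ²) that is divergence free, tangent to the boundary, and satisfies the Navier-slip conditions μ∂_y u¹(x,0)=−k₀u¹(x,0), μ∂_y u¹(x,1)=k₁u¹(x,1), ∂_x u²(±L,y)=0, obeys ‖u‖_{L^∞(Ω_L)}² ≤ C ‖u‖_{L^2(Ω_L)} ‖u‖_{H^2(Ω_L)}. -/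
open MeasureTheory Set

/-- The rectangle `Ω_L = (-L,L) × (0,1)` in `ℝ²`. -/
def rect (L : ℝ) : Set (ℝ × ℝ) := Set.Ioo (-L) L ×ˢ Set.Ioo (0 : ℝ) 1

/-- The oscillation of a function on an interval is at most the integral of its derivative. -/
lemma norm_sub_le_integral_norm_deriv {E : Type*} [NormedAddCommGroup E] [NormedSpace ℝ E]
    [CompleteSpace E] {f f' : ℝ → E} (hf : ∀ t, HasDerivAt f (f' t) t) (hf' : Continuous f')
    {a b x t : ℝ} (hx : x ∈ Icc a b) (ht : t ∈ Icc a b) :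
    ‖f x - f t‖ ≤ ∫ s in a..b, ‖f' s‖ := by
  rw [← intervalIntegral.integral_eq_sub_of_hasDerivAt (fun s _ => hf s)
    (hf'.intervalIntegrable t x)]
  refine intervalIntegral.norm_integral_le_integral_norm_uIoc.trans ?_
  rw [intervalIntegral.integral_of_le (hx.1.trans hx.2)]
  refine setIntegral_mono_set ?_ (Filter.Eventually.of_forall fun s => norm_nonneg _) ?_
  · exact (hf'.norm.intervalIntegrable a b).1
  · exact (Ioc_subset_Ioc (le_min ht.1 hx.1) (max_le ht.2 hx.2)).eventuallyLE

/-- One-dimensional embedding of `W^{1,1}` into `L^∞`. -/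
lemma norm_le_integral_norm_add_integral_norm_deriv {E : Type*} [NormedAddCommGroup E]
    [NormedSpace ℝ E] [CompleteSpace E] {f f' : ℝ → E} (hf : ∀ t, HasDerivAt f (f' t) t)
    (hf' : Continuous f') {a r x : ℝ} (hr : 0 < r) (hx : x ∈ Icc a (a + r)) :
    ‖f x‖ ≤ r⁻¹ * (∫ t in a..a + r, ‖f t‖) + ∫ t in a..a + r, ‖f' t‖ := by
  have hc : Continuous f := continuous_iff_continuousAt.2 fun t => (hf t).continuousAt
  set M := ∫ t in a..a + r, ‖f' t‖
  have key : ∀ t ∈ Icc a (a + r), ‖f x‖ - M ≤ ‖f t‖ := by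
    intro t ht
    have h1 : ‖f x - f t‖ ≤ M := norm_sub_le_integral_norm_deriv hf hf' hx ht
    have h2 := norm_sub_norm_le (f x) (f t)
    linarith
  have h := intervalIntegral.integral_mono_on (a := a) (b := a + r) (μ := volume) (by linarith)
    (continuous_const (y := ‖f x‖ - M) |>.intervalIntegrable _ _)
    (hc.norm.intervalIntegrable _ _) key
  rw [intervalIntegral.integral_const, add_sub_cancel_left, smul_eq_mul] at h
  have h3 : ‖f x‖ - M ≤ r⁻¹ * ∫ t in a..a + r, ‖f t‖ := by
    rw [inv_mul_eq_div, le_div_iff₀ hr]; linarith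
  linarith

/-- One-dimensional interpolation of the first derivative in `L^1`. -/
lemma integral_norm_deriv_le {E : Type*} [NormedAddCommGroup E] [NormedSpace ℝ E]
    [CompleteSpace E] {f f' f'' : ℝ → E} (hf : ∀ t, HasDerivAt f (f' t) t)
    (hf' : ∀ t, HasDerivAt f' (f'' t) t) (hf'' : Continuous f'') {a r : ℝ} (hr : 0 < r) :
    ∫ t in a..a + r, ‖f' t‖ ≤
      6 * r⁻¹ * (∫ t in a..a + r, ‖f t‖) + r * ∫ t in a..a + r, ‖f'' t‖ := by
  have hc : Continuous f := continuous_iff_continuousAt.2 fun t => (hf t).continuousAt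
  have hc' : Continuous f' := continuous_iff_continuousAt.2 fun t => (hf' t).continuousAt
  set M := ∫ t in a..a + r, ‖f'' t‖
  set N := ∫ t in a..a + r, ‖f t‖
  have hab : a ≤ a + r := by linarith
  set w : ℝ → ℝ := fun t => (t - a) * (a + r - t)
  set w' : ℝ → ℝ := fun t => (a + r - t) - (t - a)
  have hw : ∀ t, HasDerivAt w (w' t) t := by
    intro t
    refine (((hasDerivAt_id t).sub_const a).mul
      ((hasDerivAt_id t).const_sub (a + r))).congr_deriv ?_
    simp only [w', id_eq]; ring
  have hwc : Continuous w := by fun_prop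
  have hwc' : Continuous w' := by fun_prop
  have hwint : ∫ t in a..a + r, w t = r ^ 3 / 6 := by
    have hW : ∀ t, HasDerivAt (fun t : ℝ => r * (t - a) ^ 2 / 2 - (t - a) ^ 3 / 3) (w t) t := by
      intro t
      refine ((((((hasDerivAt_id t).sub_const a).pow 2).const_mul r).div_const 2).sub
        ((((hasDerivAt_id t).sub_const a).pow 3).div_const 3)).congr_deriv ?_
      simp only [w, id_eq]; push_cast; ring
    rw [intervalIntegral.integral_eq_sub_of_hasDerivAt (fun t _ => hW t)
      (hwc.intervalIntegrable _ _)]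
    ring
  have hparts : ‖∫ t in a..a + r, w t • f' t‖ ≤ r * N := by
    rw [intervalIntegral.integral_smul_deriv_eq_deriv_smul (fun t _ => hw t) (fun t _ => hf t)
      (hwc'.intervalIntegrable _ _) (hc'.intervalIntegrable _ _)]
    simp only [w, sub_self, zero_mul, mul_zero, zero_smul, zero_sub, norm_neg]
    refine (intervalIntegral.norm_integral_le_integral_norm hab).trans ?_
    rw [← intervalIntegral.integral_const_mul]
    refine intervalIntegral.integral_mono_on hab ((hwc'.smul hc).norm.intervalIntegrable _ _)
      ((continuous_const.mul hc.norm).intervalIntegrable _ _) fun t ht => ?_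
    rw [norm_smul]
    gcongr
    rw [Real.norm_eq_abs, abs_le]
    constructor <;> simp only [w'] <;> linarith [ht.1, ht.2]
  have hpt : ∀ x ∈ Icc a (a + r), ‖f' x‖ ≤ 6 * r⁻¹ ^ 2 * N + M := by
    intro x hx
    have h1 : ‖∫ t in a..a + r, w t • (f' x - f' t)‖ ≤ r ^ 3 / 6 * M := by
      refine (intervalIntegral.norm_integral_le_integral_norm hab).trans ?_
      rw [← hwint, ← intervalIntegral.integral_mul_const]
      refine intervalIntegral.integral_mono_on hab
        ((hwc.smul (continuous_const.sub hc')).norm.intervalIntegrable _ _)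
        ((hwc.mul continuous_const).intervalIntegrable _ _) fun t ht => ?_
      have hw0 : 0 ≤ w t := mul_nonneg (by linarith [ht.1]) (by linarith [ht.2])
      rw [norm_smul, Real.norm_of_nonneg hw0]
      gcongr
      exact norm_sub_le_integral_norm_deriv hf' hf'' hx ht
    have h2 : ∫ t in a..a + r, w t • (f' x - f' t) =
        (r ^ 3 / 6) • f' x - ∫ t in a..a + r, w t • f' t := by
      have i1 : IntervalIntegrable (fun t => w t • f' x) volume a (a + r) :=
        (hwc.smul continuous_const).intervalIntegrable _ _
      have i2 : IntervalIntegrable (fun t => w t • f' t) volume a (a + r) :=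
        (hwc.smul hc').intervalIntegrable _ _
      simp only [smul_sub]
      rw [intervalIntegral.integral_sub i1 i2, intervalIntegral.integral_smul_const, hwint]
    have h3 : r ^ 3 / 6 * ‖f' x‖ ≤ r ^ 3 / 6 * M + r * N := by
      have h4 := norm_le_norm_sub_add ((r ^ 3 / 6) • f' x) (∫ t in a..a + r, w t • f' t)
      rw [← h2, norm_smul, Real.norm_of_nonneg (by positivity)] at h4
      linarith
    refine le_of_mul_le_mul_left (h3.trans_eq ?_) (by positivity : 0 < r ^ 3 / 6)
    field_simp
    ring
  have h := intervalIntegral.integral_mono_on (μ := volume) hab (hc'.norm.intervalIntegrable _ _)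
    (continuous_const.intervalIntegrable _ _) hpt
  rw [intervalIntegral.integral_const, add_sub_cancel_left, smul_eq_mul] at h
  refine h.trans_eq ?_
  field_simp

/-- Integral over a square as an iterated integral, horizontal variable outside. -/
lemma setIntegral_square_eq {F : ℝ × ℝ → ℝ} (hF : Continuous F) {a b r : ℝ} (hr : 0 < r) :
    ∫ q in Ioc a (a + r) ×ˢ Ioc b (b + r), F q =
      ∫ x in a..a + r, ∫ y in b..b + r, F (x, y) := by
  have hint : IntegrableOn F (Ioc a (a + r) ×ˢ Ioc b (b + r)) (volume.prod volume) :=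
    (hF.continuousOn.integrableOn_compact (isCompact_Icc.prod isCompact_Icc)).mono_set
      (prod_mono Ioc_subset_Icc_self Ioc_subset_Icc_self)
  rw [Measure.volume_eq_prod, setIntegral_prod _ hint,
    intervalIntegral.integral_of_le (by linarith)]
  simp only [intervalIntegral.integral_of_le (show b ≤ b + r by linarith)]

/-- Integral over a square as an iterated integral, vertical variable outside. -/
lemma setIntegral_square_eq_swap {F : ℝ × ℝ → ℝ} (hF : Continuous F) {a b r : ℝ} (hr : 0 < r) :
    ∫ q in Ioc a (a + r) ×ˢ Ioc b (b + r), F q =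
      ∫ y in b..b + r, ∫ x in a..a + r, F (x, y) := by
  refine Eq.trans ?_ (setIntegral_square_eq (F := fun q => F q.swap)
    (hF.comp continuous_swap) hr)
  rw [Measure.volume_eq_prod, setIntegral_prod_swap]

/-- Monotonicity of the interval integral for a bound by a linear combination. -/
lemma integral_le_linear_combination {f g h : ℝ → ℝ} (hf : Continuous f) (hg : Continuous g)
    (hh : Continuous h) {a b c d : ℝ} (hab : a ≤ b)
    (H : ∀ x ∈ Icc a b, f x ≤ c * g x + d * h x) :
    ∫ x in a..b, f x ≤ c * (∫ x in a..b, g x) + d * ∫ x in a..b, h x := by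
  have ig : IntervalIntegrable (fun x => c * g x) volume a b :=
    (continuous_const.mul hg).intervalIntegrable _ _
  have ih : IntervalIntegrable (fun x => d * h x) volume a b :=
    (continuous_const.mul hh).intervalIntegrable _ _
  rw [← intervalIntegral.integral_const_mul, ← intervalIntegral.integral_const_mul,
    ← intervalIntegral.integral_add ig ih]
  exact intervalIntegral.integral_mono_on hab (hf.intervalIntegrable _ _) (ig.add ih) H

/-- Pointwise bound on a square of side `r` by scaled `L^1` norms. -/
lemma norm_le_setIntegral_square {E : Type*} [NormedAddCommGroup E] [NormedSpace ℝ E]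
    [CompleteSpace E] {u : ℝ × ℝ → E} (hu : ContDiff ℝ 2 u) {a b r : ℝ} (hr : 0 < r)
    {p : ℝ × ℝ} (hp : p ∈ Icc a (a + r) ×ˢ Icc b (b + r)) :
    ‖u p‖ ≤ 13 * r⁻¹ ^ 2 * (∫ q in Ioc a (a + r) ×ˢ Ioc b (b + r), ‖u q‖) +
      3 * ∫ q in Ioc a (a + r) ×ˢ Ioc b (b + r), ‖fderiv ℝ (fderiv ℝ u) q‖ := by
  obtain ⟨x₀, y₀⟩ := p
  have hx₀ : x₀ ∈ Icc a (a + r) := hp.1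
  have hy₀ : y₀ ∈ Icc b (b + r) := hp.2
  have ha : a ≤ a + r := by linarith
  have hb : b ≤ b + r := by linarith
  have hu1 : ContDiff ℝ 1 (fderiv ℝ u) := hu.fderiv_right (by norm_num)
  have cu : Continuous u := hu.continuous
  have cDu : Continuous (fderiv ℝ u) := hu1.continuous
  have cD2 : Continuous (fderiv ℝ (fderiv ℝ u)) := hu1.continuous_fderiv one_ne_zero
  have cnD2 : Continuous fun q => ‖fderiv ℝ (fderiv ℝ u) q‖ :=
    Continuous.norm (E := ℝ × ℝ →L[ℝ] ℝ × ℝ →L[ℝ] E) cD2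
  have hD : ∀ q, HasFDerivAt u (fderiv ℝ u q) q := fun q =>
    (hu.differentiable two_ne_zero q).hasFDerivAt
  have hD2 : ∀ q, HasFDerivAt (fderiv ℝ u) (fderiv ℝ (fderiv ℝ u) q) q := fun q =>
    (hu1.differentiable one_ne_zero q).hasFDerivAt
  have lx : ∀ x y : ℝ, HasDerivAt (fun s : ℝ => (s, y)) ((1 : ℝ), (0 : ℝ)) x := fun x y =>
    (hasDerivAt_id x).prodMk (hasDerivAt_const x y)
  have ly : ∀ x y : ℝ, HasDerivAt (fun s : ℝ => (x, s)) ((0 : ℝ), (1 : ℝ)) y := fun x y =>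
    (hasDerivAt_const y x).prodMk (hasDerivAt_id y)
  have dux : ∀ x y : ℝ, HasDerivAt (fun s => u (s, y)) (fderiv ℝ u (x, y) (1, 0)) x :=
    fun x y => (hD (x, y)).comp_hasDerivAt x (lx x y)
  have duy : ∀ x y : ℝ, HasDerivAt (fun s => u (x, s)) (fderiv ℝ u (x, y) (0, 1)) y :=
    fun x y => (hD (x, y)).comp_hasDerivAt y (ly x y)
  have dDx : ∀ (v : ℝ × ℝ) (x y : ℝ), HasDerivAt (fun s => fderiv ℝ u (s, y) v)
      (fderiv ℝ (fderiv ℝ u) (x, y) (1, 0) v) x := fun v x y =>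
    (ContinuousLinearMap.apply ℝ E v).hasFDerivAt.comp_hasDerivAt x
      ((hD2 (x, y)).comp_hasDerivAt x (lx x y))
  have dDy : ∀ (v : ℝ × ℝ) (x y : ℝ), HasDerivAt (fun s => fderiv ℝ u (x, s) v)
      (fderiv ℝ (fderiv ℝ u) (x, y) (0, 1) v) y := fun v x y =>
    (ContinuousLinearMap.apply ℝ E v).hasFDerivAt.comp_hasDerivAt y
      ((hD2 (x, y)).comp_hasDerivAt y (ly x y))
  have e1 : ‖((1 : ℝ), (0 : ℝ))‖ = 1 := by simp
  have e2 : ‖((0 : ℝ), (1 : ℝ))‖ = 1 := by simp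
  have bD2 : ∀ (q v v' : ℝ × ℝ), ‖v‖ = 1 → ‖v'‖ = 1 →
      ‖fderiv ℝ (fderiv ℝ u) q v v'‖ ≤ ‖fderiv ℝ (fderiv ℝ u) q‖ := by
    intro q v v' hv hv'
    simpa [hv, hv'] using (fderiv ℝ (fderiv ℝ u) q).le_opNorm₂ v v'
  have cpar : ∀ {F : ℝ × ℝ → ℝ}, Continuous F → ∀ c d : ℝ,
      Continuous fun x => ∫ y in c..d, F (x, y) := fun {F} hF c d =>
    intervalIntegral.continuous_parametric_intervalIntegral_of_continuous'
      (f := fun x y => F (x, y)) hF c d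
  have cpar' : ∀ {F : ℝ × ℝ → ℝ}, Continuous F → ∀ c d : ℝ,
      Continuous fun y => ∫ x in c..d, F (x, y) := fun {F} hF c d =>
    cpar (F := fun q => F q.swap) (hF.comp continuous_swap) c d
  set Q := Ioc a (a + r) ×ˢ Ioc b (b + r)
  set H := ∫ q in Q, ‖fderiv ℝ (fderiv ℝ u) q‖
  set A := ∫ q in Q, ‖u q‖ with hA
  have cux : ∀ v, Continuous fun q => fderiv ℝ u q v := fun v => cDu.clm_apply continuous_const
  have cuxx : ∀ v v', Continuous fun q => fderiv ℝ (fderiv ℝ u) q v v' := fun v v' =>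
    (cD2.clm_apply continuous_const).clm_apply continuous_const
  have hint : ∀ {F : ℝ × ℝ → ℝ}, Continuous F → IntegrableOn F Q := fun hF =>
    (hF.continuousOn.integrableOn_compact (isCompact_Icc.prod isCompact_Icc)).mono_set
      (prod_mono Ioc_subset_Icc_self Ioc_subset_Icc_self)
  have second_le : ∀ v v' : ℝ × ℝ, ‖v‖ = 1 → ‖v'‖ = 1 →
      ∫ q in Q, ‖fderiv ℝ (fderiv ℝ u) q v v'‖ ≤ H := fun v v' hv hv' =>
    setIntegral_mono (hint (cuxx v v').norm) (hint cnD2) fun q => bD2 q v v' hv hv'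
  have ux_le : ∫ q in Q, ‖fderiv ℝ u q (1, 0)‖ ≤ 6 * r⁻¹ * A + r * H := by
    have h : ∫ q in Q, ‖fderiv ℝ u q (1, 0)‖ ≤ 6 * r⁻¹ * A +
        r * ∫ q in Q, ‖fderiv ℝ (fderiv ℝ u) q (1, 0) (1, 0)‖ := by
      rw [hA, setIntegral_square_eq_swap (cux _).norm hr, setIntegral_square_eq_swap cu.norm hr,
        setIntegral_square_eq_swap (cuxx _ _).norm hr]
      refine integral_le_linear_combination (cpar' (cux _).norm _ _)
        (cpar' cu.norm _ _) (cpar' (cuxx _ _).norm _ _) hb fun y _ => ?_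
      exact integral_norm_deriv_le (fun t => dux t y) (fun t => dDx _ t y)
        ((cuxx _ _).comp (continuous_id.prodMk continuous_const)) hr
    have h2 := mul_le_mul_of_nonneg_left (second_le (1, 0) (1, 0) e1 e1) hr.le
    linarith
  have uy_le : ∫ q in Q, ‖fderiv ℝ u q (0, 1)‖ ≤ 6 * r⁻¹ * A + r * H := by
    have h : ∫ q in Q, ‖fderiv ℝ u q (0, 1)‖ ≤ 6 * r⁻¹ * A +
        r * ∫ q in Q, ‖fderiv ℝ (fderiv ℝ u) q (0, 1) (0, 1)‖ := by
      rw [hA, setIntegral_square_eq (cux _).norm hr, setIntegral_square_eq cu.norm hr,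
        setIntegral_square_eq (cuxx _ _).norm hr]
      refine integral_le_linear_combination (cpar (cux _).norm _ _)
        (cpar cu.norm _ _) (cpar (cuxx _ _).norm _ _) ha fun x _ => ?_
      exact integral_norm_deriv_le (fun t => duy x t) (fun t => dDy _ x t)
        ((cuxx _ _).comp (continuous_const.prodMk continuous_id)) hr
    have h2 := mul_le_mul_of_nonneg_left (second_le (0, 1) (0, 1) e2 e2) hr.le
    linarith
  have line_u : ∫ x in a..a + r, ‖u (x, y₀)‖ ≤
      r⁻¹ * A + ∫ q in Q, ‖fderiv ℝ u q (0, 1)‖ := by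
    rw [hA, ← one_mul (∫ q in Q, ‖fderiv ℝ u q (0, 1)‖), setIntegral_square_eq cu.norm hr,
      setIntegral_square_eq (cux _).norm hr]
    refine integral_le_linear_combination
      (cu.norm.comp (continuous_id.prodMk continuous_const))
      (cpar cu.norm _ _) (cpar (cux _).norm _ _) ha fun x _ => ?_
    rw [one_mul]
    exact norm_le_integral_norm_add_integral_norm_deriv (fun t => duy x t)
      ((cux _).comp (continuous_const.prodMk continuous_id)) hr hy₀
  have line_ux : ∫ x in a..a + r, ‖fderiv ℝ u (x, y₀) (1, 0)‖ ≤
      r⁻¹ * (∫ q in Q, ‖fderiv ℝ u q (1, 0)‖) +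
        ∫ q in Q, ‖fderiv ℝ (fderiv ℝ u) q (0, 1) (1, 0)‖ := by
    rw [← one_mul (∫ q in Q, ‖fderiv ℝ (fderiv ℝ u) q (0, 1) (1, 0)‖),
      setIntegral_square_eq (cux _).norm hr, setIntegral_square_eq (cuxx _ _).norm hr]
    refine integral_le_linear_combination
      ((cux _).norm.comp (continuous_id.prodMk continuous_const))
      (cpar (cux _).norm _ _) (cpar (cuxx _ _).norm _ _) ha fun x _ => ?_
    rw [one_mul]
    exact norm_le_integral_norm_add_integral_norm_deriv (fun t => dDy (1, 0) x t)
      ((cuxx _ _).comp (continuous_const.prodMk continuous_id)) hr hy₀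
  have hpt := norm_le_integral_norm_add_integral_norm_deriv (fun t => dux t y₀)
    ((cux (1, 0)).comp (continuous_id.prodMk continuous_const)) hr hx₀
  have hmix := second_le (0, 1) (1, 0) e2 e1
  calc ‖u (x₀, y₀)‖ ≤ r⁻¹ * (r⁻¹ * A + (6 * r⁻¹ * A + r * H)) +
        (r⁻¹ * (6 * r⁻¹ * A + r * H) + H) := by
        refine hpt.trans (add_le_add ?_ (line_ux.trans ?_))
        · gcongr; exact line_u.trans (by gcongr)
        · gcongr
    _ = 13 * r⁻¹ ^ 2 * A + 3 * H := by field_simp; ring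

/-- Cauchy–Schwarz on a square of side `r`. -/
lemma setIntegral_square_le {F : ℝ × ℝ → ℝ} (hF : Continuous F) {a b r : ℝ} (hr : 0 < r) :
    ∫ q in Ioc a (a + r) ×ˢ Ioc b (b + r), F q ≤
      r * √(∫ q in Ioc a (a + r) ×ˢ Ioc b (b + r), F q ^ 2) := by
  set Q := Ioc a (a + r) ×ˢ Ioc b (b + r)
  have hint : ∀ {G : ℝ × ℝ → ℝ}, Continuous G → IntegrableOn G Q := fun hG =>
    (hG.continuousOn.integrableOn_compact (isCompact_Icc.prod isCompact_Icc)).mono_set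
      (prod_mono Ioc_subset_Icc_self Ioc_subset_Icc_self)
  set I := ∫ q in Q, F q
  set J := ∫ q in Q, F q ^ 2
  have hvol : volume.real Q = r ^ 2 := by
    simp [Q, Measure.real, Measure.volume_eq_prod, hr.le, sq]
  have hvar : ∫ q in Q, (F q - I / r ^ 2) ^ 2 = J - I ^ 2 / r ^ 2 := by
    have : ∀ q, (F q - I / r ^ 2) ^ 2 = F q ^ 2 - 2 * (I / r ^ 2) * F q + (I / r ^ 2) ^ 2 :=
      fun q => by ring
    simp only [this]
    rw [integral_add (hint (by fun_prop)) (hint (by fun_prop)),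
      integral_sub (hint (by fun_prop)) (hint (by fun_prop)), integral_const_mul,
      setIntegral_const, hvol, smul_eq_mul]
    change J - 2 * (I / r ^ 2) * I + r ^ 2 * (I / r ^ 2) ^ 2 = _
    field_simp
    ring
  have h0 : 0 ≤ J - I ^ 2 / r ^ 2 := hvar ▸ integral_nonneg fun q => sq_nonneg _
  have h1 : (I / r) ^ 2 ≤ J := by rw [div_pow]; linarith
  have h2 := Real.le_sqrt_of_sq_le h1
  rw [div_le_iff₀ hr] at h2
  linarith

/-- Optimisation over the scale `r`. -/
lemma sq_le_of_forall_scale {N A H : ℝ} (hN : 0 ≤ N) (hA : 0 ≤ A) (hAH : A ≤ H)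
    (h : ∀ r : ℝ, 0 < r → r ≤ 1 / 2 → N ≤ 13 * r⁻¹ * A + 3 * r * H) :
    N ^ 2 ≤ 800 * A * H := by
  rcases hA.eq_or_lt with rfl | hA
  · have : N ≤ 0 := by
      refine le_of_forall_pos_le_add fun ε hε => ?_
      have hd : 0 < 3 * H + 2 * ε := by linarith
      have hr := h (ε / (3 * H + 2 * ε)) (by positivity)
        (by rw [div_le_div_iff₀ hd two_pos]; linarith)
      refine hr.trans ?_
      rw [mul_zero, zero_add, zero_add,
        show 3 * (ε / (3 * H + 2 * ε)) * H = ε * (3 * H) / (3 * H + 2 * ε) by ring, div_le_iff₀ hd]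
      nlinarith
    rw [le_antisymm this hN]; simp
  · have hH : 0 < H := hA.trans_le hAH
    obtain ⟨α, hα, rfl⟩ : ∃ α, 0 < α ∧ A = α ^ 2 :=
      ⟨√A, Real.sqrt_pos.2 hA, (Real.sq_sqrt hA.le).symm⟩
    obtain ⟨β, hβ, rfl⟩ : ∃ β, 0 < β ∧ H = β ^ 2 :=
      ⟨√H, Real.sqrt_pos.2 hH, (Real.sq_sqrt hH.le).symm⟩
    have hαβ : α ≤ β := le_of_sq_le_sq hAH hβ.le
    have hr := h (α / (2 * β)) (by positivity)
      (by rw [div_le_div_iff₀ (by positivity) two_pos]; linarith)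
    have h1 : 13 * (α / (2 * β))⁻¹ * α ^ 2 + 3 * (α / (2 * β)) * β ^ 2 = 55 / 2 * (α * β) := by
      field_simp; ring
    rw [h1] at hr
    calc N ^ 2 ≤ (55 / 2 * (α * β)) ^ 2 := by gcongr
      _ ≤ 800 * α ^ 2 * β ^ 2 := by nlinarith [sq_nonneg (α * β)]

/-- Every point of an interval of length at least `1` is in a closed subinterval of length
`r ≤ 1 / 2` whose half-open version stays inside. -/
lemma exists_Ioc_subset_Ioo {c d x r : ℝ} (hcd : 1 ≤ d - c) (hx : x ∈ Ioo c d) (hr : 0 < r)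
    (hr2 : r ≤ 1 / 2) : ∃ a, x ∈ Icc a (a + r) ∧ Ioc a (a + r) ⊆ Ioo c d := by
  obtain ⟨h1, h2⟩ := hx
  rcases lt_or_ge x (c + 1 / 2) with h | h
  · exact ⟨x, ⟨le_rfl, by linarith⟩, fun t ht => ⟨by linarith [ht.1], by linarith [ht.2]⟩⟩
  · exact ⟨x - r, ⟨by linarith, by linarith⟩,
      fun t ht => ⟨by linarith [ht.1], by linarith [ht.2]⟩⟩

/-- Uniform-in-`L` Agmon-type inequality under Navier-slip boundary conditions on
`Ω_L = (-L,L)×(0,1)`: `‖u‖²_{L^∞} ≤ C ‖u‖_{L²} ‖u‖_{H²}` with `C = C(μ,k₀,k₁)`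
independent of `L ≥ 1`. -/
theorem uniform_agmon (μ k₀ k₁ : ℝ) (hμ : 0 < μ) :
    ∃ C > 0, ∀ (L : ℝ), 1 ≤ L → ∀ (u : ℝ × ℝ → ℝ × ℝ),
      ContDiff ℝ 2 u →
      (∀ p : ℝ × ℝ, dx (fun q => (u q).1) p + dy (fun q => (u q).2) p = 0) →
      (∀ y ∈ Set.Icc (0 : ℝ) 1, (u (-L, y)).1 = 0 ∧ (u (L, y)).1 = 0) →
      (∀ x ∈ Set.Icc (-L) L, (u (x, 0)).2 = 0 ∧ (u (x, 1)).2 = 0) →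
      (∀ x ∈ Set.Icc (-L) L,
        μ * dy (fun q => (u q).1) (x, 0) = -k₀ * (u (x, 0)).1 ∧
        μ * dy (fun q => (u q).1) (x, 1) = k₁ * (u (x, 1)).1) →
      (∀ y ∈ Set.Icc (0 : ℝ) 1,
        dx (fun q => (u q).2) (-L, y) = 0 ∧ dx (fun q => (u q).2) (L, y) = 0) →
      ∀ p ∈ rect L,
        ‖u p‖ ^ 2 ≤
          C * (∫ q in rect L, ‖u q‖ ^ 2) ^ ((1 : ℝ) / 2) *
            ((∫ q in rect L, ‖u q‖ ^ 2) + (∫ q in rect L, ‖fderiv ℝ u q‖ ^ 2) +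
              (∫ q in rect L, ‖fderiv ℝ (fderiv ℝ u) q‖ ^ 2)) ^ ((1 : ℝ) / 2) := by
  refine ⟨800, by norm_num, fun L hL u hu _ _ _ _ _ p hp => ?_⟩
  have hint : ∀ {G : ℝ × ℝ → ℝ}, Continuous G → IntegrableOn G (rect L) := fun hG =>
    (hG.continuousOn.integrableOn_compact (isCompact_Icc.prod isCompact_Icc)).mono_set
      (prod_mono Ioo_subset_Icc_self Ioo_subset_Icc_self)
  have hu1 : ContDiff ℝ 1 (fderiv ℝ u) := hu.fderiv_right (by norm_num)
  have cu : Continuous u := hu.continuous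
  have cD2 : Continuous (fderiv ℝ (fderiv ℝ u)) := hu1.continuous_fderiv one_ne_zero
  have cnD2 : Continuous fun q => ‖fderiv ℝ (fderiv ℝ u) q‖ :=
    Continuous.norm (E := ℝ × ℝ →L[ℝ] ℝ × ℝ →L[ℝ] ℝ × ℝ) cD2
  have hI0 : 0 ≤ ∫ q in rect L, ‖u q‖ ^ 2 := integral_nonneg fun q => sq_nonneg _
  have hI1 : 0 ≤ ∫ q in rect L, ‖fderiv ℝ u q‖ ^ 2 := integral_nonneg fun q => sq_nonneg _
  have hI2 : 0 ≤ ∫ q in rect L, ‖fderiv ℝ (fderiv ℝ u) q‖ ^ 2 :=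
    integral_nonneg fun q => sq_nonneg _
  rw [← Real.sqrt_eq_rpow, ← Real.sqrt_eq_rpow]
  refine sq_le_of_forall_scale (norm_nonneg _) (Real.sqrt_nonneg _)
    (Real.sqrt_le_sqrt (by linarith)) fun r hr hr2 => ?_
  obtain ⟨a, hpa, ha⟩ := exists_Ioc_subset_Ioo (by linarith) hp.1 hr hr2
  obtain ⟨b, hpb, hb⟩ := exists_Ioc_subset_Ioo (by norm_num) hp.2 hr hr2
  have hsub : Ioc a (a + r) ×ˢ Ioc b (b + r) ⊆ rect L := prod_mono ha hb
  have hle : ∀ {G : ℝ × ℝ → ℝ}, Continuous G →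
      ∫ q in Ioc a (a + r) ×ˢ Ioc b (b + r), G q ^ 2 ≤ ∫ q in rect L, G q ^ 2 := fun hG =>
    setIntegral_mono_set (hint (hG.pow 2)) (Filter.Eventually.of_forall fun q => sq_nonneg _)
      hsub.eventuallyLE
  have hA : ∫ q in Ioc a (a + r) ×ˢ Ioc b (b + r), ‖u q‖ ≤
      r * √(∫ q in rect L, ‖u q‖ ^ 2) :=
    (setIntegral_square_le cu.norm hr).trans <|
      mul_le_mul_of_nonneg_left (Real.sqrt_le_sqrt (hle cu.norm)) hr.le
  have hH : ∫ q in Ioc a (a + r) ×ˢ Ioc b (b + r), ‖fderiv ℝ (fderiv ℝ u) q‖ ≤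
      r * √((∫ q in rect L, ‖u q‖ ^ 2) + (∫ q in rect L, ‖fderiv ℝ u q‖ ^ 2) +
        (∫ q in rect L, ‖fderiv ℝ (fderiv ℝ u) q‖ ^ 2)) :=
    (setIntegral_square_le cnD2 hr).trans <|
      mul_le_mul_of_nonneg_left (Real.sqrt_le_sqrt ((hle cnD2).trans (by linarith))) hr.le
  refine (norm_le_setIntegral_square hu hr ⟨hpa, hpb⟩).trans ?_
  refine (add_le_add (mul_le_mul_of_nonneg_left hA (by positivity))
    (mul_le_mul_of_nonneg_left hH (by positivity))).trans_eq ?_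
  field_simp
end
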